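/- Let G = (Q, Σ, δ, I) be a DES with a single observable event, i.e., Σ_o = {a}, and let T_spec ⊆ Q × Q be a specification. Then G is strongly periodically D-detectable with respect to T_spec if and only if the set {m ∈ ℕ : (R(I, a^m) × R(I, a^m)) ∩ T_spec = ∅} is infinite. -/

import Mathlib

/-! Common framework for discrete event systems (DES) modeled as NFAs. -/

/-- One step of the transition function extended to sets of states. -/
def dStep {Q E : Type*} (δ : Q → E → Set Q) (X : Set Q) (a : E) : Set Q :=
  ⋃ q ∈ X, δ q a

/-- The transition function extended to sets of states and strings (lists of events). -/
def dRun {Q E : Type*} (δ : Q → E → Set Q) (X : Set Q) : List E → Set Q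
  | [] => X
  | a :: w => dRun δ (dStep δ X a) w

/-- The natural projection erasing the unobservable events (those not in `obs`). -/
noncomputable def proj {E : Type*} (obs : Set E) : List E → List E
  | [] => []
  | a :: w => @ite _ (a ∈ obs) (Classical.propDecidable _)
      (a :: proj obs w) (proj obs w)

/-- `Rset δ obs X t` is the set `R(X, t)` of all states reachable from `X`
under some string whose projection is the observation `t`. -/
def Rset {Q E : Type*} (δ : Q → E → Set Q) (obs : Set E) (X : Set Q) (t : List E) : Set Q :=
  {q | ∃ w : List E, proj obs w = t ∧ q ∈ dRun δ X w}

/-- `s : ℕ → E` is an infinite trajectory of the system, i.e. `s ∈ L^ω(G)`. -/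
def IsTrajectory {Q E : Type*} (δ : Q → E → Set Q) (I : Set Q) (s : ℕ → E) : Prop :=
  ∃ r : ℕ → Q, r 0 ∈ I ∧ ∀ n, r (n + 1) ∈ δ (r n) (s n)

/-- The prefix of length `n` of an infinite trajectory. -/
def prefixOf {E : Type*} (s : ℕ → E) (n : ℕ) : List E := (List.range n).map s

/-- The segment of a trajectory between positions `m` and `m'`,
so that `prefixOf s m' = prefixOf s m ++ segmentOf s m m'` whenever `m ≤ m'`. -/
def segmentOf {E : Type*} (s : ℕ → E) (m m' : ℕ) : List E :=
  (List.range (m' - m)).map fun i => s (m + i)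

/-- Every state has at least one outgoing transition. -/
def DeadlockFree {Q E : Type*} (δ : Q → E → Set Q) : Prop :=
  ∀ q : Q, ∃ a : E, (δ q a).Nonempty

/-- No loop consists solely of unobservable events. -/
def NoUnobservableLoop {Q E : Type*} (δ : Q → E → Set Q) (obs : Set E) : Prop :=
  ∀ (q : Q) (w : List E), w ≠ [] → (∀ a ∈ w, a ∉ obs) → q ∉ dRun δ {q} w

/-- Strong detectability. -/
def StronglyDetectable {Q E : Type*} (δ : Q → E → Set Q) (obs : Set E) (I : Set Q) : Prop :=
  ∃ n : ℕ, ∀ s : ℕ → E, IsTrajectory δ I s → ∀ m : ℕ,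
    (proj obs (prefixOf s m)).length > n →
    (Rset δ obs I (proj obs (prefixOf s m))).ncard = 1

/-- Weak detectability. -/
def WeaklyDetectable {Q E : Type*} (δ : Q → E → Set Q) (obs : Set E) (I : Set Q) : Prop :=
  ∃ n : ℕ, ∃ s : ℕ → E, IsTrajectory δ I s ∧ ∀ m : ℕ,
    (proj obs (prefixOf s m)).length > n →
    (Rset δ obs I (proj obs (prefixOf s m))).ncard = 1

/-- Strong periodic detectability. -/
def StronglyPeriodicallyDetectable {Q E : Type*} (δ : Q → E → Set Q) (obs : Set E)
    (I : Set Q) : Prop :=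
  ∃ n : ℕ, ∀ s : ℕ → E, IsTrajectory δ I s → ∀ m : ℕ, ∃ m' : ℕ, m ≤ m' ∧
    (proj obs (segmentOf s m m')).length < n ∧
    (Rset δ obs I (proj obs (prefixOf s m'))).ncard = 1

/-- Weak periodic detectability. -/
def WeaklyPeriodicallyDetectable {Q E : Type*} (δ : Q → E → Set Q) (obs : Set E)
    (I : Set Q) : Prop :=
  ∃ n : ℕ, ∃ s : ℕ → E, IsTrajectory δ I s ∧ ∀ m : ℕ, ∃ m' : ℕ, m ≤ m' ∧
    (proj obs (segmentOf s m m')).length < n ∧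
    (Rset δ obs I (proj obs (prefixOf s m'))).ncard = 1

/-- Strong D-detectability with respect to a specification `T`. -/
def StronglyDDetectable {Q E : Type*} (δ : Q → E → Set Q) (obs : Set E) (I : Set Q)
    (T : Set (Q × Q)) : Prop :=
  ∃ n : ℕ, ∀ s : ℕ → E, IsTrajectory δ I s → ∀ m : ℕ,
    (proj obs (prefixOf s m)).length > n →
    (Rset δ obs I (proj obs (prefixOf s m)) ×ˢ Rset δ obs I (proj obs (prefixOf s m))) ∩ T = ∅

/-- Weak D-detectability with respect to a specification `T`. -/
def WeaklyDDetectable {Q E : Type*} (δ : Q → E → Set Q) (obs : Set E) (I : Set Q)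
    (T : Set (Q × Q)) : Prop :=
  ∃ n : ℕ, ∃ s : ℕ → E, IsTrajectory δ I s ∧ ∀ m : ℕ,
    (proj obs (prefixOf s m)).length > n →
    (Rset δ obs I (proj obs (prefixOf s m)) ×ˢ Rset δ obs I (proj obs (prefixOf s m))) ∩ T = ∅

/-- Strong periodic D-detectability with respect to a specification `T`. -/
def StronglyPeriodicallyDDetectable {Q E : Type*} (δ : Q → E → Set Q) (obs : Set E)
    (I : Set Q) (T : Set (Q × Q)) : Prop :=
  ∃ n : ℕ, ∀ s : ℕ → E, IsTrajectory δ I s → ∀ m : ℕ, ∃ m' : ℕ, m ≤ m' ∧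
    (proj obs (segmentOf s m m')).length < n ∧
    (Rset δ obs I (proj obs (prefixOf s m')) ×ˢ Rset δ obs I (proj obs (prefixOf s m'))) ∩ T = ∅

/-- Weak periodic D-detectability with respect to a specification `T`. -/
def WeaklyPeriodicallyDDetectable {Q E : Type*} (δ : Q → E → Set Q) (obs : Set E)
    (I : Set Q) (T : Set (Q × Q)) : Prop :=
  ∃ n : ℕ, ∃ s : ℕ → E, IsTrajectory δ I s ∧ ∀ m : ℕ, ∃ m' : ℕ, m ≤ m' ∧
    (proj obs (segmentOf s m m')).length < n ∧
    (Rset δ obs I (proj obs (prefixOf s m')) ×ˢ Rset δ obs I (proj obs (prefixOf s m'))) ∩ T = ∅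

theorem dRun_append {Q E : Type*} (δ : Q → E → Set Q) (X : Set Q) (u v : List E) :
    dRun δ X (u ++ v) = dRun δ (dRun δ X u) v := by
  induction u generalizing X with
  | nil => rfl
  | cons b u ih => exact ih _

theorem mem_dRun_iff_exists_singleton {Q E : Type*} (δ : Q → E → Set Q) (X : Set Q)
    (w : List E) (q : Q) : q ∈ dRun δ X w ↔ ∃ x ∈ X, q ∈ dRun δ {x} w := by
  induction w generalizing X with
  | nil => simp [dRun]
  | cons b w ih =>
    simp only [dRun]
    rw [ih]
    constructor
    · rintro ⟨y, hy, hq⟩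
      simp only [dStep, Set.mem_iUnion, exists_prop] at hy
      obtain ⟨x, hx, hy⟩ := hy
      refine ⟨x, hx, (ih _).2 ⟨y, ?_, hq⟩⟩
      simpa [dStep] using hy
    · rintro ⟨x, hx, hq⟩
      obtain ⟨y, hy, hq⟩ := (ih _).1 hq
      refine ⟨y, ?_, hq⟩
      simp only [dStep, Set.mem_iUnion, exists_prop, Set.mem_singleton_iff, exists_eq_left] at hy ⊢
      exact ⟨x, hx, hy⟩

theorem proj_cons_of_mem {E : Type*} {obs : Set E} {b : E} (hb : b ∈ obs) (w : List E) :
    proj obs (b :: w) = b :: proj obs w := by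
  simp [proj, hb]

theorem proj_cons_of_notMem {E : Type*} {obs : Set E} {b : E} (hb : b ∉ obs) (w : List E) :
    proj obs (b :: w) = proj obs w := by
  simp [proj, hb]

theorem proj_append {E : Type*} (obs : Set E) (u v : List E) :
    proj obs (u ++ v) = proj obs u ++ proj obs v := by
  induction u with
  | nil => rfl
  | cons b u ih =>
    by_cases hb : b ∈ obs
    · simp [proj_cons_of_mem hb, ih]
    · simp [proj_cons_of_notMem hb, ih]

theorem exists_append_of_proj_eq_append {E : Type*} {obs : Set E} (w s t : List E)
    (h : proj obs w = s ++ t) : ∃ u v, w = u ++ v ∧ proj obs u = s ∧ proj obs v = t := by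
  induction w generalizing s with
  | nil =>
    obtain ⟨rfl, rfl⟩ := List.append_eq_nil_iff.1 h.symm
    exact ⟨[], [], rfl, rfl, rfl⟩
  | cons b w ih =>
    by_cases hb : b ∈ obs
    · cases s with
      | nil => exact ⟨[], b :: w, rfl, rfl, h⟩
      | cons c s =>
        rw [proj_cons_of_mem hb, List.cons_append, List.cons.injEq] at h
        obtain ⟨u, v, rfl, hu, hv⟩ := ih s h.2
        exact ⟨b :: u, v, rfl, by rw [proj_cons_of_mem hb, hu, h.1], hv⟩
    · rw [proj_cons_of_notMem hb] at h
      obtain ⟨u, v, rfl, hu, hv⟩ := ih s h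
      exact ⟨b :: u, v, rfl, by rw [proj_cons_of_notMem hb, hu], hv⟩

theorem Rset_append {Q E : Type*} (δ : Q → E → Set Q) (obs : Set E) (X : Set Q)
    (s t : List E) : Rset δ obs X (s ++ t) = Rset δ obs (Rset δ obs X s) t := by
  ext q
  constructor
  · rintro ⟨w, hw, hq⟩
    obtain ⟨u, v, rfl, hu, hv⟩ := exists_append_of_proj_eq_append w s t hw
    rw [dRun_append, mem_dRun_iff_exists_singleton] at hq
    obtain ⟨x, hx, hq⟩ := hq
    exact ⟨v, hv, (mem_dRun_iff_exists_singleton ..).2 ⟨x, ⟨u, hu, hx⟩, hq⟩⟩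
  · rintro ⟨v, hv, hq⟩
    obtain ⟨x, ⟨u, hu, hx⟩, hq⟩ := (mem_dRun_iff_exists_singleton ..).1 hq
    refine ⟨u ++ v, by rw [proj_append, hu, hv], ?_⟩
    rw [dRun_append]
    exact (mem_dRun_iff_exists_singleton ..).2 ⟨x, hx, hq⟩

theorem proj_singleton_eq_replicate {E : Type*} (a : E) (w : List E) :
    proj {a} w = List.replicate (proj {a} w).length a := by
  induction w with
  | nil => rfl
  | cons b w ih =>
    by_cases hb : b ∈ ({a} : Set E)
    · rw [proj_cons_of_mem hb, List.length_cons, List.replicate_succ, ← ih,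
        Set.mem_singleton_iff.1 hb]
    · rwa [proj_cons_of_notMem hb]

theorem prefixOf_append_segmentOf {E : Type*} (s : ℕ → E) {m m' : ℕ} (h : m ≤ m') :
    prefixOf s m ++ segmentOf s m m' = prefixOf s m' := by
  obtain ⟨k, rfl⟩ := Nat.exists_eq_add_of_le h
  simp [prefixOf, segmentOf, List.range_add, Function.comp_def]

theorem prefixOf_succ {E : Type*} (s : ℕ → E) (m : ℕ) :
    prefixOf s (m + 1) = prefixOf s m ++ [s m] := by
  simp [prefixOf, List.range_succ]

theorem length_proj_prefixOf_add {E : Type*} (obs : Set E) (s : ℕ → E) {m m' : ℕ}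
    (h : m ≤ m') : (proj obs (prefixOf s m)).length + (proj obs (segmentOf s m m')).length =
      (proj obs (prefixOf s m')).length := by
  rw [← prefixOf_append_segmentOf s h, proj_append, List.length_append]

theorem length_proj_prefixOf_mono {E : Type*} (obs : Set E) (s : ℕ → E) :
    Monotone fun m => (proj obs (prefixOf s m)).length := fun _ _ h => by
  have := length_proj_prefixOf_add obs s h
  dsimp only
  omega

theorem length_proj_prefixOf_succ_le {E : Type*} (obs : Set E) (s : ℕ → E) (m : ℕ) :
    (proj obs (prefixOf s (m + 1))).length ≤ (proj obs (prefixOf s m)).length + 1 := by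
  rw [prefixOf_succ, proj_append, List.length_append]
  by_cases h : s m ∈ obs
  · rw [proj_cons_of_mem h]
    rfl
  · rw [proj_cons_of_notMem h]
    exact Nat.le_succ _

theorem length_proj_prefixOf_succ_of_mem {E : Type*} {obs : Set E} {s : ℕ → E} {m : ℕ}
    (h : s m ∈ obs) :
    (proj obs (prefixOf s (m + 1))).length = (proj obs (prefixOf s m)).length + 1 := by
  rw [prefixOf_succ, proj_append, List.length_append, proj_cons_of_mem h]
  rfl

theorem mem_dRun_segment {Q E : Type*} {δ : Q → E → Set Q} {r : ℕ → Q} {s : ℕ → E}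
    (hr : ∀ n, r (n + 1) ∈ δ (r n) (s n)) (i k : ℕ) :
    r (i + k) ∈ dRun δ {r i} ((List.range k).map fun j => s (i + j)) := by
  induction k with
  | zero => simp [dRun]
  | succ k ih =>
    rw [List.range_succ, List.map_append, dRun_append]
    simp only [List.map_cons, List.map_nil, dRun, dStep, Set.mem_iUnion, exists_prop]
    exact ⟨_, ih, hr (i + k)⟩

/-- A trajectory of a finite system without unobservable loops has observable events
arbitrarily late. -/
theorem exists_observable_ge {Q E : Type*} [Finite Q] {δ : Q → E → Set Q} {obs : Set E}
    (hnl : NoUnobservableLoop δ obs) {I : Set Q} {s : ℕ → E} (hs : IsTrajectory δ I s)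
    (M : ℕ) : ∃ m ≥ M, s m ∈ obs := by
  obtain ⟨r, -, hr⟩ := hs
  by_contra! hM
  obtain ⟨i, j, hij, heq⟩ : ∃ i j, i < j ∧ r (M + i) = r (M + j) := by
    obtain ⟨i, j, hne, heq⟩ := Finite.exists_ne_map_eq_of_infinite fun i => r (M + i)
    rcases Nat.lt_or_gt_of_ne hne with h | h
    exacts [⟨i, j, h, heq⟩, ⟨j, i, h, heq.symm⟩]
  have hmem := mem_dRun_segment hr (M + i) (j - i)
  rw [show M + i + (j - i) = M + j by omega, ← heq] at hmem
  refine hnl _ _ ?_ ?_ hmem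
  · simp only [ne_eq, List.map_eq_nil_iff, List.range_eq_nil]
    omega
  · intro b hb
    obtain ⟨l, -, rfl⟩ := List.mem_map.1 hb
    exact hM _ (by omega)

theorem exists_le_length_proj_prefixOf {Q E : Type*} [Finite Q] {δ : Q → E → Set Q}
    {obs : Set E} (hnl : NoUnobservableLoop δ obs) {I : Set Q} {s : ℕ → E}
    (hs : IsTrajectory δ I s) (N : ℕ) : ∃ m, N ≤ (proj obs (prefixOf s m)).length := by
  induction N with
  | zero => exact ⟨0, Nat.zero_le _⟩
  | succ N ih =>
    obtain ⟨m, hm⟩ := ih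
    obtain ⟨m', hm', hobs⟩ := exists_observable_ge hnl hs m
    refine ⟨m' + 1, ?_⟩
    rw [length_proj_prefixOf_succ_of_mem hobs]
    exact Nat.succ_le_succ (hm.trans (length_proj_prefixOf_mono obs s hm'))

theorem exists_ge_length_proj_prefixOf_eq {Q E : Type*} [Finite Q] {δ : Q → E → Set Q}
    {obs : Set E} (hnl : NoUnobservableLoop δ obs) {I : Set Q} {s : ℕ → E}
    (hs : IsTrajectory δ I s) (m k : ℕ) :
    ∃ m' ≥ m, (proj obs (prefixOf s m')).length = (proj obs (prefixOf s m)).length + k := by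
  induction k with
  | zero => exact ⟨m, le_rfl, rfl⟩
  | succ k ih =>
    obtain ⟨l, hl, hlen⟩ := ih
    classical
    have hex := exists_le_length_proj_prefixOf hnl hs ((proj obs (prefixOf s m)).length + (k + 1))
    have hspec := Nat.find_spec hex
    have hlt : l < Nat.find hex := by
      by_contra! h
      have := length_proj_prefixOf_mono obs s h
      dsimp only at this
      omega
    refine ⟨Nat.find hex, (hl.trans_lt hlt).le, le_antisymm ?_ hspec⟩
    have hmin := Nat.find_min hex (m := Nat.find hex - 1) (by omega)
    have hstep := length_proj_prefixOf_succ_le obs s (Nat.find hex - 1)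
    rw [Nat.sub_add_cancel (by omega)] at hstep
    omega

theorem DeadlockFree.exists_isTrajectory {Q E : Type*} {δ : Q → E → Set Q}
    (hdf : DeadlockFree δ) {I : Set Q} (hI : I.Nonempty) : ∃ s, IsTrajectory δ I s := by
  obtain ⟨q, hq⟩ := hI
  choose e next hnext using hdf
  exact ⟨fun n => e (next^[n] q), fun n => next^[n] q, hq, fun n => by
    dsimp only
    rw [Function.iterate_succ_apply']
    exact hnext _⟩

/-- In a finite-valued sequence in which each term determines the following ones, a property
that holds for infinitely many terms recurs within bounded gaps. -/
theorem exists_gap_bound {S : Type*} [Finite S] {X : ℕ → S}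
    (hX : ∀ m m' k, X m = X m' → X (m + k) = X (m' + k)) {p : S → Prop}
    (hinf : {m | p (X m)}.Infinite) : ∃ K, ∀ m, ∃ k ≤ K, p (X (m + k)) := by
  have hk : ∀ Y, ∃ k, ∀ m, X m = Y → p (X (m + k)) := by
    intro Y
    by_cases hY : ∃ m₀, X m₀ = Y
    · obtain ⟨m₀, rfl⟩ := hY
      obtain ⟨l, hl, hlt⟩ := hinf.exists_gt m₀
      refine ⟨l - m₀, fun m hm => ?_⟩
      rw [hX m m₀ _ hm, Nat.add_sub_cancel' hlt.le]
      exact hl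
    · exact ⟨0, fun m hm => (hY ⟨m, hm⟩).elim⟩
  choose f hf using hk
  obtain ⟨K, hK⟩ := (Set.finite_range f).bddAbove
  exact ⟨K, fun m => ⟨f (X m), hK ⟨X m, rfl⟩, hf _ m rfl⟩⟩

/-- a DES `G = (Q, Σ, δ, I)` with a single observable event `Σ_o = {a}` is
strongly periodically D-detectable w.r.t. a specification `T_spec` if and only if the set
`{m ∈ ℕ : (R(I, a^m) × R(I, a^m)) ∩ T_spec = ∅}` is infinite. -/
theorem statement14 {Q E : Type*} [Fintype Q] [Fintype E]
    (δ : Q → E → Set Q) (a : E) (I : Set Q) (Tspec : Set (Q × Q))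
    (hI : I.Nonempty) (hdf : DeadlockFree δ) (hnl : NoUnobservableLoop δ ({a} : Set E)) :
    StronglyPeriodicallyDDetectable δ ({a} : Set E) I Tspec ↔
      {m : ℕ | (Rset δ ({a} : Set E) I (List.replicate m a) ×ˢ
        Rset δ ({a} : Set E) I (List.replicate m a)) ∩ Tspec = ∅}.Infinite := by
  constructor
  · rintro ⟨n, hn⟩
    obtain ⟨s, hs⟩ := hdf.exists_isTrajectory hI
    refine Set.infinite_of_forall_exists_gt fun N => ?_
    obtain ⟨m, hm⟩ := exists_le_length_proj_prefixOf hnl hs (N + 1)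
    obtain ⟨m', hmm', -, hgood⟩ := hn s hs m
    rw [proj_singleton_eq_replicate] at hgood
    exact ⟨_, hgood, hm.trans (length_proj_prefixOf_mono {a} s hmm')⟩
  · intro hinf
    obtain ⟨K, hK⟩ := exists_gap_bound
      (X := fun m => Rset δ ({a} : Set E) I (List.replicate m a))
      (p := fun Y => (Y ×ˢ Y) ∩ Tspec = ∅)
      (fun m m' k h => by
        rw [List.replicate_add, List.replicate_add, Rset_append, Rset_append, h]) hinf
    refine ⟨K + 1, fun s hs m => ?_⟩
    obtain ⟨k, hkK, hgood⟩ := hK (proj {a} (prefixOf s m)).length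
    obtain ⟨m', hmm', hlen⟩ := exists_ge_length_proj_prefixOf_eq hnl hs m k
    refine ⟨m', hmm', ?_, ?_⟩
    · have := length_proj_prefixOf_add {a} s hmm'
      omega
    · rw [proj_singleton_eq_replicate, hlen]
      exact hgood
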